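/- arXiv:0812.4154 — 2 statements merged into one kernel-verified Lean document; each statement's English description precedes it below -/
import Mathlib

section
/- Let P be a regular T-palindromic matrix polynomial of degree m ≥ 1 with n×n coefficients, let v ∈ ℂ^m with ‖v‖₂ = 1 and Rv = v, and let L_p(z) = zX + Y with X = Yᵀ be a T-palindromic pencil in L₁(P) with right ansatz vector v. Let λ ∈ ℂ with Re(λ) ≥ 0 and x ∈ ℂⁿ with ‖x‖₂ = 1 and P(λ)x ≠ 0. Then √(1 − 2Re(λ)/|1+λ|²) · √((m+1)/m) ≤ η_F^{S_p}(λ, Λ_{m−1}(λ) ⊗ x, L_p) / η_F(λ, x, P) ≤ √2. -/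
noncomputable section

/-- Euclidean (ℓ²) norm of a complex vector. -/
def vnorm {α : Type*} [Fintype α] (x : α → ℂ) : ℝ :=
  Real.sqrt (∑ i, ‖x i‖ ^ 2)

/-- Frobenius norm of a complex matrix. -/
def frobNorm {α : Type*} [Fintype α] (A : Matrix α α ℂ) : ℝ :=
  Real.sqrt (∑ i, ∑ j, ‖A i j‖ ^ 2)

/-- Spectral (operator 2-)norm of a complex matrix. -/
def specNorm {α : Type*} [Fintype α] [DecidableEq α] (A : Matrix α α ℂ) : ℝ :=
  ‖Matrix.toEuclideanCLM (𝕜 := ℂ) A‖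

/-- Evaluation of the matrix polynomial `P(z) = ∑_{j=0}^m z^j A_j`. -/
def evalP {n : ℕ} (m : ℕ) (A : ℕ → Matrix (Fin n) (Fin n) ℂ) (z : ℂ) :
    Matrix (Fin n) (Fin n) ℂ :=
  ∑ j ∈ Finset.range (m + 1), z ^ j • A j

/-- `‖Λ_m‖₂² = ∑_{j=0}^m |λ|^{2j}` where `Λ_m = (1, λ, …, λ^m)ᵀ`. -/
def LamNormSq (m : ℕ) (lam : ℂ) : ℝ :=
  ∑ j ∈ Finset.range (m + 1), ‖lam‖ ^ (2 * j)

/-- `‖Π₊(Λ_m)‖₂²`. -/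
def PiPlusSq (m : ℕ) (lam : ℂ) : ℝ :=
  if m % 2 = 1 then
    ∑ j ∈ Finset.range ((m + 1) / 2), ‖lam ^ j + lam ^ (m - j)‖ ^ 2 / 2
  else
    (∑ j ∈ Finset.range (m / 2), ‖lam ^ j + lam ^ (m - j)‖ ^ 2 / 2) + ‖lam ^ (m / 2)‖ ^ 2

/-- `‖Π₋(Λ_m)‖₂²`. -/
def PiMinusSq (m : ℕ) (lam : ℂ) : ℝ :=
  if m % 2 = 1 then
    ∑ j ∈ Finset.range ((m + 1) / 2), ‖lam ^ j - lam ^ (m - j)‖ ^ 2 / 2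
  else
    ∑ j ∈ Finset.range (m / 2), ‖lam ^ j - lam ^ (m - j)‖ ^ 2 / 2

/-- `Λ_{m-1}(z) = (z^{m-1}, …, z, 1)ᵀ ∈ ℂ^m`. -/
def Lam1 (m : ℕ) (z : ℂ) : Fin m → ℂ := fun i => z ^ (m - 1 - (i : ℕ))

/-- Kronecker product of a vector in `ℂ^m` with a vector in `ℂ^n`. -/
def vKron {m n : ℕ} (u : Fin m → ℂ) (x : Fin n → ℂ) : Fin m × Fin n → ℂ :=
  fun p => u p.1 * x p.2

/-- Kronecker product `u ⊗ B` of a column vector `u ∈ ℂ^m` with an `n × n` matrix `B`,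
an `mn × n` matrix. -/
def colKron {m n : ℕ} (u : Fin m → ℂ) (B : Matrix (Fin n) (Fin n) ℂ) :
    Matrix (Fin m × Fin n) (Fin n) ℂ :=
  fun p j => u p.1 * B p.2 j

/-- Frobenius-norm structured backward error of `(λ, u)` for the pencil `L(z) = zX + Y`
over T-palindromic pencil perturbations (`ΔX = ΔYᵀ`). -/
def etaPencilF_Tpal {m n : ℕ} (X Y : Matrix (Fin m × Fin n) (Fin m × Fin n) ℂ)
    (lam : ℂ) (u : Fin m × Fin n → ℂ) : ℝ :=
  sInf { e : ℝ | ∃ ΔX ΔY : Matrix (Fin m × Fin n) (Fin m × Fin n) ℂ,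
    ΔX = ΔY.transpose ∧
    (lam • X + Y + lam • ΔX + ΔY).mulVec u = 0 ∧
    e = Real.sqrt (frobNorm ΔX ^ 2 + frobNorm ΔY ^ 2) }

/-- Frobenius-norm structured backward error of `(λ, u)` for the pencil `L(z) = zX + Y`
over T-anti-palindromic pencil perturbations (`ΔX = −ΔYᵀ`). -/
def etaPencilF_Tapal {m n : ℕ} (X Y : Matrix (Fin m × Fin n) (Fin m × Fin n) ℂ)
    (lam : ℂ) (u : Fin m × Fin n → ℂ) : ℝ :=
  sInf { e : ℝ | ∃ ΔX ΔY : Matrix (Fin m × Fin n) (Fin m × Fin n) ℂ,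
    ΔX = -ΔY.transpose ∧
    (lam • X + Y + lam • ΔX + ΔY).mulVec u = 0 ∧
    e = Real.sqrt (frobNorm ΔX ^ 2 + frobNorm ΔY ^ 2) }

lemma aux_orth {α : Type*} [Fintype α] (u p : α → ℂ) (h : ∑ j, u j * p j = 0) (c d : ℂ) :
    ∑ j, ‖c * (starRingEnd ℂ) (u j) + d * p j‖ ^ 2
      = ‖c‖ ^ 2 * ∑ j, ‖u j‖ ^ 2 + ‖d‖ ^ 2 * ∑ j, ‖p j‖ ^ 2 := by
  have hz : ∑ j, ((c * (starRingEnd ℂ) (u j)) * (starRingEnd ℂ) (d * p j)).re = 0 := by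
    rw [← Complex.re_sum]
    have : ∑ j, (c * (starRingEnd ℂ) (u j)) * (starRingEnd ℂ) (d * p j)
        = c * (starRingEnd ℂ) d * (starRingEnd ℂ) (∑ j, u j * p j) := by
      rw [map_sum, Finset.mul_sum]
      refine Finset.sum_congr rfl fun j _ => ?_
      simp only [map_mul]; ring
    rw [this, h]; simp
  have hp : ∀ j, ‖c * (starRingEnd ℂ) (u j) + d * p j‖ ^ 2
      = ‖c‖ ^ 2 * ‖u j‖ ^ 2 + ‖d‖ ^ 2 * ‖p j‖ ^ 2
        + 2 * ((c * (starRingEnd ℂ) (u j)) * (starRingEnd ℂ) (d * p j)).re := by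
    intro j
    rw [← Complex.normSq_eq_norm_sq, Complex.normSq_add]
    simp only [Complex.normSq_eq_norm_sq, norm_mul, mul_pow, RCLike.norm_conj]
  simp only [hp, Finset.sum_add_distrib, ← Finset.mul_sum, hz]
  ring

lemma aux_norm1 (lam : ℂ) : ‖1 + lam‖ ^ 2 = 1 + ‖lam‖ ^ 2 + 2 * lam.re := by
  rw [← Complex.normSq_eq_norm_sq, Complex.normSq_add, ← Complex.normSq_eq_norm_sq]
  simp

lemma aux_upper {α : Type*} [Fintype α] (u r : α → ℂ) (lam : ℂ) (hre : 0 ≤ lam.re)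
    (N : ℝ) (hN : ∑ j, ‖u j‖ ^ 2 = N) (hpos : 0 < N) :
    ∃ E : Matrix α α ℂ, (lam • E.transpose + E).mulVec u = r ∧
      ∑ i, ∑ j, ‖E i j‖ ^ 2 ≤ (∑ j, ‖r j‖ ^ 2) / (N * (1 + ‖lam‖ ^ 2)) := by
  have hNc : (N : ℂ) ≠ 0 := by exact_mod_cast hpos.ne'
  have huu : ∑ j, (starRingEnd ℂ) (u j) * u j = (N : ℂ) := by
    rw [← hN]; push_cast
    exact Finset.sum_congr rfl fun j _ => Complex.conj_mul' _
  have huu' : ∑ j, u j * (starRingEnd ℂ) (u j) = (N : ℂ) := by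
    rw [← huu]; exact Finset.sum_congr rfl fun j _ => mul_comm _ _
  have h1 : (1 + lam) ≠ 0 := by
    intro h
    have := congrArg Complex.re h
    simp at this; linarith
  have hD : 0 < 1 + ‖lam‖ ^ 2 := by positivity
  have hDc : ((1 + ‖lam‖ ^ 2 : ℝ) : ℂ) ≠ 0 := by exact_mod_cast hD.ne'
  set D : ℝ := 1 + ‖lam‖ ^ 2 with hDdef
  have hDl : (1 : ℂ) + lam * (starRingEnd ℂ) lam = (D : ℂ) := by
    rw [Complex.mul_conj']; push_cast [hDdef]; ring
  set al : ℂ := ∑ j, u j * r j with hal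
  set p : α → ℂ := fun j => r j - al / N * (starRingEnd ℂ) (u j) with hp
  have hup : ∑ j, u j * p j = 0 := by
    have : ∀ j, u j * p j = u j * r j - al / N * (u j * (starRingEnd ℂ) (u j)) := by
      intro j; simp only [hp]; ring
    simp only [this, Finset.sum_sub_distrib, ← Finset.mul_sum, huu']
    rw [← hal]; field_simp; ring
  have hpu : ∑ j, p j * u j = 0 := by
    rw [← hup]; exact Finset.sum_congr rfl fun j _ => mul_comm _ _
  have hr : ∀ j, r j = al / N * (starRingEnd ℂ) (u j) + 1 * p j := by
    intro j; simp only [hp]; ring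
  have hR : ∑ j, ‖r j‖ ^ 2 = ‖al / N‖ ^ 2 * N + ∑ j, ‖p j‖ ^ 2 := by
    have := aux_orth u p hup (al / N) 1
    simp only [← hr] at this
    rw [this, hN]; simp
  set be : ℂ := al / (N ^ 2 * (1 + lam)) with hbe
  set a : ℂ := 1 / (N * D) with ha
  set b : ℂ := (starRingEnd ℂ) lam / (N * D) with hb
  set E : Matrix α α ℂ := Matrix.of fun i j =>
    (be * (starRingEnd ℂ) (u i) + a * p i) * (starRingEnd ℂ) (u j)
      + (b * (starRingEnd ℂ) (u i)) * p j with hE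
  refine ⟨E, ?_, ?_⟩
  · funext i
    have hterm : ∀ j, (lam • E.transpose + E) i j * u j
        = ((1 + lam) * be * (starRingEnd ℂ) (u i) + (a + lam * b) * p i)
            * ((starRingEnd ℂ) (u j) * u j)
          + (b * (starRingEnd ℂ) (u i) + lam * a * (starRingEnd ℂ) (u i)) * (p j * u j) := by
      intro j
      simp only [hE, Matrix.add_apply, Matrix.smul_apply, Matrix.transpose_apply, Matrix.of_apply,
        smul_eq_mul]
      ring
    simp only [Matrix.mulVec, dotProduct, hterm, Finset.sum_add_distrib, ← Finset.mul_sum, huu, hpu]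
    have e1 : (1 + lam) * be * N = al / N := by rw [hbe]; field_simp
    have e2 : (a + lam * b) * N = 1 := by
      have : (a + lam * b) * N = (1 + lam * (starRingEnd ℂ) lam) / D := by
        rw [ha, hb]; field_simp
      rw [this, hDl]; field_simp
    rw [hr i]
    linear_combination (starRingEnd ℂ) (u i) * e1 + p i * e2
  · have hs : ∑ i, ∑ j, ‖E i j‖ ^ 2
        = (‖be‖ ^ 2 * N + ‖a‖ ^ 2 * ∑ j, ‖p j‖ ^ 2) * N + ‖b‖ ^ 2 * N * ∑ j, ‖p j‖ ^ 2 := by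
      simp only [hE, Matrix.of_apply, aux_orth u p hup, hN, Finset.sum_add_distrib,
        ← Finset.sum_mul, norm_mul, mul_pow, RCLike.norm_conj, ← Finset.mul_sum]
    have hq : 0 ≤ ∑ j, ‖p j‖ ^ 2 := by positivity
    rw [hs, hR]
    generalize (∑ j, ‖p j‖ ^ 2) = Q at *
    have nbe : ‖be‖ ^ 2 = ‖al‖ ^ 2 / (N ^ 4 * ‖1 + lam‖ ^ 2) := by
      rw [hbe]; simp [abs_of_pos hpos, div_pow, mul_pow]; ring
    have na : ‖a‖ ^ 2 = 1 / (N ^ 2 * D ^ 2) := by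
      rw [ha]; simp [abs_of_pos hpos, abs_of_pos hD, mul_pow]
    have nb : ‖b‖ ^ 2 = (D - 1) / (N ^ 2 * D ^ 2) := by
      have hD1 : D - 1 = ‖lam‖ ^ 2 := by rw [hDdef]; ring
      rw [hb, hD1]; simp [abs_of_pos hpos, abs_of_pos hD, mul_pow, div_pow]
    have nal : ‖al / N‖ ^ 2 = ‖al‖ ^ 2 / N ^ 2 := by
      simp [abs_of_pos hpos, div_pow]
    have hDle : D ≤ ‖1 + lam‖ ^ 2 := by rw [aux_norm1]; linarith
    rw [nbe, na, nb, nal]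
    have hT : 0 < ‖1 + lam‖ ^ 2 := lt_of_lt_of_le hD hDle
    have key : ‖al‖ ^ 2 / (N ^ 2 * ‖1 + lam‖ ^ 2) ≤ ‖al‖ ^ 2 / (N ^ 2 * D) := by gcongr
    calc _ = ‖al‖ ^ 2 / (N ^ 2 * ‖1 + lam‖ ^ 2) + Q / (N * D) := by field_simp; ring
      _ ≤ ‖al‖ ^ 2 / (N ^ 2 * D) + Q / (N * D) := by linarith
      _ = _ := by field_simp

lemma aux_pair (lam a b : ℂ) (hre : 0 ≤ lam.re) :
    ‖lam * a + b‖ ^ 2 + ‖lam * b + a‖ ^ 2 ≤ ‖1 + lam‖ ^ 2 * (‖a‖ ^ 2 + ‖b‖ ^ 2) := by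
  simp only [← Complex.normSq_eq_norm_sq, Complex.normSq_apply, Complex.add_re, Complex.add_im,
    Complex.mul_re, Complex.mul_im, Complex.one_re, Complex.one_im]
  have : 0 ≤ lam.re * ((a.re - b.re) ^ 2 + (a.im - b.im) ^ 2) := by positivity
  nlinarith

lemma aux_lower {α : Type*} [Fintype α] (u : α → ℂ) (lam : ℂ) (hre : 0 ≤ lam.re)
    (E : Matrix α α ℂ) :
    ∑ i, ‖(lam • E.transpose + E).mulVec u i‖ ^ 2
      ≤ ‖1 + lam‖ ^ 2 * (∑ i, ∑ j, ‖E i j‖ ^ 2) * ∑ j, ‖u j‖ ^ 2 := by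
  have h1 : ∑ i, ‖(lam • E.transpose + E).mulVec u i‖ ^ 2
      ≤ (∑ i, ∑ j, ‖lam * E j i + E i j‖ ^ 2) * ∑ j, ‖u j‖ ^ 2 := by
    rw [Finset.sum_mul]
    refine Finset.sum_le_sum fun i _ => ?_
    refine le_trans ?_ (Finset.sum_mul_sq_le_sq_mul_sq Finset.univ
      (fun j => ‖lam * E j i + E i j‖) (fun j => ‖u j‖))
    gcongr
    simp only [Matrix.mulVec, dotProduct, Matrix.add_apply, Matrix.smul_apply,
      Matrix.transpose_apply, smul_eq_mul]
    refine (norm_sum_le _ _).trans (le_of_eq ?_)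
    simp only [norm_mul]
  have h2 : ∑ i, ∑ j, ‖lam * E j i + E i j‖ ^ 2 ≤ ‖1 + lam‖ ^ 2 * (∑ i, ∑ j, ‖E i j‖ ^ 2) := by
    have hc : ∑ i, ∑ j, ‖lam * E j i + E i j‖ ^ 2 = ∑ i, ∑ j, ‖lam * E i j + E j i‖ ^ 2 :=
      Finset.sum_comm
    have hc' : ∑ i, ∑ j, ‖E j i‖ ^ 2 = ∑ i, ∑ j, ‖E i j‖ ^ 2 := Finset.sum_comm
    have : ∑ i, ∑ j, (‖lam * E j i + E i j‖ ^ 2 + ‖lam * E i j + E j i‖ ^ 2)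
        ≤ ∑ i, ∑ j, ‖1 + lam‖ ^ 2 * (‖E j i‖ ^ 2 + ‖E i j‖ ^ 2) :=
      Finset.sum_le_sum fun i _ => Finset.sum_le_sum fun j _ => aux_pair _ _ _ hre
    simp only [Finset.sum_add_distrib, ← Finset.mul_sum] at this
    rw [← hc, hc'] at this
    linarith
  refine h1.trans ?_
  gcongr

lemma aux_chord (t : ℝ) (ht : 0 ≤ t) (m : ℕ) :
    2 * ∑ j ∈ Finset.range (m + 1), t ^ j ≤ (m + 1) * (1 + t ^ m) := by
  have hf : ∑ j ∈ Finset.range (m + 1), t ^ (m - j) = ∑ j ∈ Finset.range (m + 1), t ^ j := by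
    have := Finset.sum_range_reflect (fun j => t ^ j) (m + 1)
    simpa using this
  have : ∑ j ∈ Finset.range (m + 1), (t ^ j + t ^ (m - j))
      ≤ ∑ j ∈ Finset.range (m + 1), (1 + t ^ m) := by
    refine Finset.sum_le_sum fun j hj => ?_
    have hj' : j ≤ m := by simpa [Nat.lt_succ_iff] using hj
    have e : t ^ m = t ^ j * t ^ (m - j) := by rw [← pow_add]; congr 1; omega
    rw [e]
    have : 0 ≤ (1 - t ^ j) * (1 - t ^ (m - j)) := by
      rcases le_total t 1 with h | h
      · exact mul_nonneg (by linarith [pow_le_one₀ ht h (n := j)])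
          (by linarith [pow_le_one₀ ht h (n := m - j)])
      · exact mul_nonneg_of_nonpos_of_nonpos (by linarith [one_le_pow₀ h (n := j)])
          (by linarith [one_le_pow₀ h (n := m - j)])
    linarith
  rw [Finset.sum_add_distrib, hf] at this
  simp at this
  linarith

set_option maxHeartbeats 2000000 in
/-- Frobenius backward-error comparison between a T-palindromic
linearization `L_p` (ansatz `Rv = v`) and a T-palindromic polynomial `P`, for Re λ ≥ 0. -/
theorem stmt_13 {m n : ℕ} (hm : 1 ≤ m) (hn : 0 < n)
    (A : ℕ → Matrix (Fin n) (Fin n) ℂ)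
    (hpal : ∀ j ≤ m, A (m - j) = (A j).transpose)
    (hreg : ∃ z : ℂ, (evalP m A z).det ≠ 0)
    (v : Fin m → ℂ) (hv1 : vnorm v = 1) (hvR : ∀ i : Fin m, v i.rev = v i)
    (X Y : Matrix (Fin m × Fin n) (Fin m × Fin n) ℂ) (hXY : X = Y.transpose)
    (hL : ∀ z : ℂ, (z • X + Y) * colKron (Lam1 m z) (1 : Matrix (Fin n) (Fin n) ℂ)
        = colKron v (evalP m A z))
    (lam : ℂ) (hre : 0 ≤ lam.re)
    (x : Fin n → ℂ) (hx : vnorm x = 1)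
    (hnz : (evalP m A lam).mulVec x ≠ 0) :
    Real.sqrt (1 - 2 * lam.re / ‖1 + lam‖ ^ 2) * Real.sqrt (((m : ℝ) + 1) / m) ≤
        etaPencilF_Tpal X Y lam (vKron (Lam1 m lam) x) /
          (vnorm ((evalP m A lam).mulVec x) / Real.sqrt (LamNormSq m lam)) ∧
      etaPencilF_Tpal X Y lam (vKron (Lam1 m lam) x) /
          (vnorm ((evalP m A lam).mulVec x) / Real.sqrt (LamNormSq m lam)) ≤
        Real.sqrt 2 := by
  classical
  set t : ℝ := ‖lam‖ ^ 2 with ht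
  have ht0 : 0 ≤ t := by positivity
  set u := vKron (Lam1 m lam) x with hu
  set q := (evalP m A lam).mulVec x with hq
  set N : ℝ := ∑ j ∈ Finset.range m, t ^ j with hNdef
  set M : ℝ := LamNormSq m lam with hMdef
  have hM : M = ∑ j ∈ Finset.range (m + 1), t ^ j := by
    simp only [hMdef, LamNormSq, ht, pow_mul]
  have hM1 : M = N + t ^ m := by rw [hM, Finset.sum_range_succ]
  have hM2 : M = t * N + 1 := by
    rw [hM, Finset.sum_range_succ', hNdef, Finset.mul_sum]
    simp [pow_succ, mul_comm]
  have hx' : ∑ i, ‖x i‖ ^ 2 = 1 := by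
    unfold vnorm at hx; exact Real.sqrt_eq_one.mp hx
  have hv' : ∑ i, ‖v i‖ ^ 2 = 1 := by
    unfold vnorm at hv1; exact Real.sqrt_eq_one.mp hv1
  have hkr : ∀ (a : Fin m → ℂ) (b : Fin n → ℂ),
      ∑ i, ‖vKron a b i‖ ^ 2 = (∑ i, ‖a i‖ ^ 2) * ∑ i, ‖b i‖ ^ 2 := by
    intro a b
    rw [Fintype.sum_prod_type, Finset.sum_mul_sum]
    simp [vKron, mul_pow]
  have hN : ∑ j, ‖u j‖ ^ 2 = N := by
    rw [hu, hkr, hx', mul_one]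
    have := Finset.sum_range_reflect (fun j => t ^ j) m
    rw [hNdef, ← this, ← Fin.sum_univ_eq_sum_range (fun j => t ^ (m - 1 - j)) m]
    refine Finset.sum_congr rfl fun i _ => ?_
    rw [Lam1, norm_pow, ht, ← pow_mul, ← pow_mul, mul_comm]
  have hN1 : 1 ≤ N := by
    have : t ^ 0 ≤ N := Finset.single_le_sum (f := fun j => t ^ j)
      (fun j _ => by positivity) (Finset.mem_range.mpr (by omega))
    simpa using this
  have hNpos : 0 < N := by linarith
  have hLu : (lam • X + Y).mulVec u = vKron v q := by
    have h1 : (colKron (Lam1 m lam) (1 : Matrix (Fin n) (Fin n) ℂ)).mulVec x = u := by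
      funext p
      simp [Matrix.mulVec, dotProduct, colKron, hu, vKron, Matrix.one_apply]
    rw [← h1, Matrix.mulVec_mulVec, hL lam]
    funext p
    simp [Matrix.mulVec, dotProduct, colKron, vKron, hq, Finset.mul_sum, mul_assoc]
  set Q : ℝ := ∑ i, ‖q i‖ ^ 2 with hQ
  have hr : ∑ i, ‖vKron v q i‖ ^ 2 = Q := by rw [hkr, hv', one_mul]
  have hQpos : 0 < Q := by
    obtain ⟨i, hi⟩ := Function.ne_iff.mp hnz
    exact Finset.sum_pos' (fun i _ => by positivity)
      ⟨i, Finset.mem_univ _, by have := norm_pos_iff.mpr hi; positivity⟩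
  have hMpos : 0 < M := by rw [hM2]; positivity
  have hT := aux_norm1 lam
  have hTpos : 0 < ‖1 + lam‖ ^ 2 := by rw [hT]; positivity
  have hfr : ∀ E : Matrix (Fin m × Fin n) (Fin m × Fin n) ℂ,
      frobNorm E.transpose ^ 2 + frobNorm E ^ 2 = 2 * ∑ i, ∑ j, ‖E i j‖ ^ 2 := by
    intro E
    unfold frobNorm
    rw [Real.sq_sqrt (by positivity), Real.sq_sqrt (by positivity)]
    have : ∑ i, ∑ j, ‖E.transpose i j‖ ^ 2 = ∑ i, ∑ j, ‖E i j‖ ^ 2 := Finset.sum_comm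
    rw [this]; ring
  have hden : vnorm q / Real.sqrt M = Real.sqrt (Q / M) := by
    rw [Real.sqrt_div hQpos.le]; rfl
  obtain ⟨E0, hE0, hE0n⟩ := aux_upper u (-vKron v q) lam hre N hN hNpos
  have hmem : Real.sqrt (2 * ∑ i, ∑ j, ‖E0 i j‖ ^ 2) ∈ { e : ℝ |
      ∃ ΔX ΔY : Matrix (Fin m × Fin n) (Fin m × Fin n) ℂ,
      ΔX = ΔY.transpose ∧ (lam • X + Y + lam • ΔX + ΔY).mulVec u = 0 ∧
      e = Real.sqrt (frobNorm ΔX ^ 2 + frobNorm ΔY ^ 2) } := by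
    refine ⟨E0.transpose, E0, rfl, ?_, by rw [hfr]⟩
    rw [add_assoc, Matrix.add_mulVec, hE0, hLu]; simp
  rw [hden]
  have hQM : 0 < Real.sqrt (Q / M) := Real.sqrt_pos.mpr (by positivity)
  rw [le_div_iff₀ hQM, div_le_iff₀ hQM]
  have hm0 : (0 : ℝ) < m := by exact_mod_cast hm
  constructor
  · refine le_csInf ⟨_, hmem⟩ ?_
    rintro e ⟨ΔX, E, rfl, hE, rfl⟩
    rw [hfr]
    rw [add_assoc, Matrix.add_mulVec, hLu] at hE
    have hlow := aux_lower u lam hre E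
    rw [eq_neg_of_add_eq_zero_right hE, hN] at hlow
    simp only [Pi.neg_apply, norm_neg, hr] at hlow
    generalize (∑ i, ∑ j, ‖E i j‖ ^ 2) = F at hlow
    have he : 1 - 2 * lam.re / ‖1 + lam‖ ^ 2 = (1 + t) / ‖1 + lam‖ ^ 2 := by
      rw [eq_div_iff hTpos.ne', sub_mul, div_mul_cancel₀ _ hTpos.ne', hT]; ring
    rw [he, ← Real.sqrt_mul (by positivity), ← Real.sqrt_mul (by positivity)]
    apply Real.sqrt_le_sqrt
    have hch := aux_chord t ht0 m
    rw [← hM] at hch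
    have hkey : (m + 1) * (N * (1 + t)) ≤ 2 * m * M := by
      have h3 : N * (1 + t) = 2 * M - (1 + t ^ m) := by linarith
      rw [h3]; nlinarith
    have hF : Q / (‖1 + lam‖ ^ 2 * N) ≤ F := by
      rw [div_le_iff₀ (by positivity)]; linarith
    refine le_trans ?_ (mul_le_mul_of_nonneg_left hF (by norm_num))
    rw [div_mul_div_comm, div_mul_div_comm, ← mul_div_assoc,
      div_le_div_iff₀ (by positivity) (by positivity)]
    have := mul_le_mul_of_nonneg_left hkey (mul_nonneg hQpos.le hTpos.le)
    linarith
  · refine (csInf_le ⟨0, ?_⟩ hmem).trans ?_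
    · rintro e ⟨_, _, _, _, rfl⟩
      exact Real.sqrt_nonneg _
    · rw [← Real.sqrt_mul (by norm_num)]
      apply Real.sqrt_le_sqrt
      refine mul_le_mul_of_nonneg_left (hE0n.trans ?_) (by norm_num)
      simp only [Pi.neg_apply, norm_neg, hr]
      apply div_le_div_of_nonneg_left hQpos.le hMpos
      rw [← ht]; linarith
end
end

section
/- Let P be a regular T-palindromic matrix polynomial of degree m ≥ 1 with n×n coefficients, let v ∈ ℂ^m with ‖v‖₂ = 1 and Rv = −v, and let L_ap(z) = zX + Y with X = −Yᵀ be a T-anti-palindromic pencil in L₁(P) with right ansatz vector v. Let λ ∈ ℂ with Re(λ) ≤ 0 and x ∈ ℂⁿ with ‖x‖₂ = 1 and P(λ)x ≠ 0. Then √(1 + 2Re(λ)/|1−λ|²) · √((m+1)/m) ≤ η_F^{S_ap}(λ, Λ_{m−1}(λ) ⊗ x, L_ap) / η_F(λ, x, P) ≤ √2. -/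
noncomputable section

open Finset in
lemma pyth_aux {ι : Type*} [Fintype ι] (w p : ι → ℂ)
    (h : ∑ j, (starRingEnd ℂ) (w j) * p j = 0) (a b : ℂ) :
    ∑ j, ‖a * w j + b * p j‖ ^ 2 = ‖a‖ ^ 2 * ∑ j, ‖w j‖ ^ 2 + ‖b‖ ^ 2 * ∑ j, ‖p j‖ ^ 2 := by
  have key : ∀ j, ‖a * w j + b * p j‖ ^ 2 = ‖a‖ ^ 2 * ‖w j‖ ^ 2 + ‖b‖ ^ 2 * ‖p j‖ ^ 2
      + 2 * ((starRingEnd ℂ) a * b * ((starRingEnd ℂ) (w j) * p j)).re := by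
    intro j
    simp only [← Complex.normSq_eq_norm_sq, Complex.normSq_apply, Complex.add_re, Complex.add_im,
      Complex.mul_re, Complex.mul_im, Complex.conj_re, Complex.conj_im]
    ring
  simp only [key, sum_add_distrib, ← mul_sum, ← Complex.re_sum]
  rw [h]; simp

open Finset in
lemma exists_pert {ι : Type*} [Fintype ι] (lam : ℂ) (hre : lam.re ≤ 0) (u r : ι → ℂ)
    (hu : 0 < ∑ j, ‖u j‖ ^ 2) :
    ∃ E : Matrix ι ι ℂ, (∀ i, ∑ j, (E i j - lam * E j i) * u j = - r i) ∧
      (∑ i, ∑ j, ‖E i j‖ ^ 2) * ((∑ j, ‖u j‖ ^ 2) * (1 + ‖lam‖ ^ 2)) ≤ ∑ j, ‖r j‖ ^ 2 := by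
  set s : ℝ := ∑ j, ‖u j‖ ^ 2 with hs
  have hsc : (s : ℂ) ≠ 0 := by exact_mod_cast hu.ne'
  have huu : ∑ j, (starRingEnd ℂ) (u j) * u j = (s : ℂ) := by
    rw [hs]; push_cast
    exact sum_congr rfl fun j _ => by rw [Complex.conj_mul']
  have h1 : (1 : ℂ) - lam ≠ 0 := by
    intro h
    have := congrArg Complex.re h
    simp at this; linarith
  set c : ℂ := ∑ j, u j * r j with hc
  set w : ι → ℂ := fun j => (starRingEnd ℂ) (u j) / s with hw
  set p : ι → ℂ := fun j => r j - c * w j with hp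
  have hwu : ∑ j, w j * u j = 1 := by
    simp only [hw, div_mul_eq_mul_div]
    rw [← sum_div, huu, div_self hsc]
  have hpu : ∑ j, p j * u j = 0 := by
    simp only [hp, sub_mul, sum_sub_distrib, mul_assoc, ← mul_sum]
    rw [hwu, hc]
    simp [mul_comm]
  have hwp : ∑ j, (starRingEnd ℂ) (w j) * p j = 0 := by
    have : ∀ j, (starRingEnd ℂ) (w j) * p j = p j * u j / s := by
      intro j; simp [hw]; ring
    simp only [this, ← sum_div, hpu, zero_div]
  have hww : ∑ j, ‖w j‖ ^ 2 = 1 / s := by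
    simp only [hw, norm_div, div_pow, ← sum_div, RCLike.norm_conj, ← hs]
    simp [abs_of_pos hu]
    field_simp
  set q : ℝ := 1 + ‖lam‖ ^ 2 with hq
  have hq0 : 0 < q := by positivity
  have hqc : (q : ℂ) ≠ 0 := by exact_mod_cast hq0.ne'
  have hqc' : (q : ℂ) = 1 + lam * (starRingEnd ℂ) lam := by
    rw [Complex.mul_conj', hq]; push_cast; rfl
  set α : ℂ := -c / (1 - lam) with hα
  set β : ℂ := -1 / q with hβ
  set γ : ℂ := (starRingEnd ℂ) lam / q with hγ
  have hbg : β - lam * γ = -1 := by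
    rw [hβ, hγ]; field_simp; rw [hqc']; ring
  have hbg2 : ‖β‖ ^ 2 + ‖γ‖ ^ 2 = 1 / q := by
    simp only [hβ, hγ, norm_div, div_pow, RCLike.norm_conj, norm_neg, norm_one,
      Complex.norm_real, Real.norm_eq_abs, sq_abs]
    rw [← add_div, one_pow, ← hq]; field_simp
  have hα1 : α * (1 - lam) = -c := by rw [hα]; field_simp
  have hq1 : q ≤ ‖1 - lam‖ ^ 2 := by
    rw [hq]
    simp only [← Complex.normSq_eq_norm_sq, Complex.normSq_apply, Complex.sub_re, Complex.sub_im,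
      Complex.one_re, Complex.one_im]
    nlinarith
  refine ⟨fun i j => (α * w i + β * p i) * w j + (γ * w i) * p j, ?_, ?_⟩
  · intro i
    have : ∀ j, ((α * w i + β * p i) * w j + (γ * w i) * p j
        - lam * ((α * w j + β * p j) * w i + (γ * w j) * p i)) * u j
        = (α * (1 - lam) * w i + (β - lam * γ) * p i) * (w j * u j)
          + (γ - lam * β) * w i * (p j * u j) := by
      intro j; ring
    simp only [this, sum_add_distrib, ← mul_sum, hwu, hpu, hbg, hα1]
    simp only [hp]; ring
  · have hr : ∑ j, ‖r j‖ ^ 2 = ‖c‖ ^ 2 * (1 / s) + ∑ j, ‖p j‖ ^ 2 := by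
      have := pyth_aux w p hwp c 1
      rw [hww] at this
      simpa [hp] using this
    have hrow : ∀ i, ∑ j, ‖(α * w i + β * p i) * w j + (γ * w i) * p j‖ ^ 2
        = ‖α * w i + β * p i‖ ^ 2 * (1 / s) + ‖γ‖ ^ 2 * ‖w i‖ ^ 2 * ∑ j, ‖p j‖ ^ 2 := by
      intro i
      rw [pyth_aux w p hwp, hww, norm_mul, mul_pow]
    simp only [hrow, sum_add_distrib, ← sum_mul, ← mul_sum]
    rw [pyth_aux w p hwp, hww, hr]
    set T := ∑ j, ‖p j‖ ^ 2 with hT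
    have e : ((‖α‖ ^ 2 * (1 / s) + ‖β‖ ^ 2 * T) * (1 / s) + ‖γ‖ ^ 2 * (1 / s) * T) * (s * q)
        = ‖α‖ ^ 2 * q * (1 / s) + (‖β‖ ^ 2 + ‖γ‖ ^ 2) * q * T := by
      field_simp; ring
    rw [e, hbg2]
    have : ‖α‖ ^ 2 * q ≤ ‖c‖ ^ 2 := by
      have h2 : ‖c‖ ^ 2 = ‖α‖ ^ 2 * ‖1 - lam‖ ^ 2 := by
        rw [← mul_pow, ← norm_mul, hα1, norm_neg]
      rw [h2]; gcongr
    have h3 : 1 / q * q * T = T := by field_simp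
    rw [h3]; gcongr

open Finset in
lemma pert_lower {ι : Type*} [Fintype ι] (lam : ℂ) (hre : lam.re ≤ 0) (u r : ι → ℂ)
    (E : Matrix ι ι ℂ) (hE : ∀ i, ∑ j, (E i j - lam * E j i) * u j = - r i) :
    ∑ j, ‖r j‖ ^ 2 ≤ (∑ j, ‖u j‖ ^ 2) * ‖1 - lam‖ ^ 2 * ∑ i, ∑ j, ‖E i j‖ ^ 2 := by
  have h1 : ∀ i, ‖r i‖ ^ 2 ≤ (∑ j, ‖E i j - lam * E j i‖ ^ 2) * ∑ j, ‖u j‖ ^ 2 := by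
    intro i
    rw [← norm_neg, ← hE i]
    calc _ ≤ (∑ j, ‖E i j - lam * E j i‖ * ‖u j‖) ^ 2 := by
          gcongr
          exact (norm_sum_le _ _).trans (by simp)
      _ ≤ _ := sum_mul_sq_le_sq_mul_sq _ _ _
  have h2 : ∑ i, ∑ j, ‖E i j - lam * E j i‖ ^ 2 ≤ ‖1 - lam‖ ^ 2 * ∑ i, ∑ j, ‖E i j‖ ^ 2 := by
    have pw : ∀ a b : ℂ, ‖a - lam * b‖ ^ 2 + ‖b - lam * a‖ ^ 2
        ≤ ‖1 - lam‖ ^ 2 * (‖a‖ ^ 2 + ‖b‖ ^ 2) := by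
      intro a b
      have : ‖a - lam * b‖ ^ 2 + ‖b - lam * a‖ ^ 2
        = ‖1 - lam‖ ^ 2 * (‖a‖ ^ 2 + ‖b‖ ^ 2) + 2 * lam.re * ‖a - b‖ ^ 2 := by
        simp only [← Complex.normSq_eq_norm_sq, Complex.normSq_apply, Complex.sub_re,
          Complex.sub_im, Complex.one_re, Complex.one_im, Complex.mul_re, Complex.mul_im]
        ring
      rw [this]
      nlinarith [sq_nonneg ‖a - b‖]
    have s1 : ∑ i, ∑ j, ‖E i j - lam * E j i‖ ^ 2 = ∑ i, ∑ j, ‖E j i - lam * E i j‖ ^ 2 :=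
      sum_comm
    have s2 : ∑ i, ∑ j, ‖E i j‖ ^ 2 = ∑ i, ∑ j, ‖E j i‖ ^ 2 := sum_comm
    have s3 : ∑ i, ∑ j, (‖E i j - lam * E j i‖ ^ 2 + ‖E j i - lam * E i j‖ ^ 2)
        ≤ ∑ i, ∑ j, ‖1 - lam‖ ^ 2 * (‖E i j‖ ^ 2 + ‖E j i‖ ^ 2) :=
      sum_le_sum fun i _ => sum_le_sum fun j _ => pw _ _
    simp only [sum_add_distrib, ← mul_sum] at s3
    rw [← s1, ← s2] at s3
    linarith
  calc _ ≤ ∑ i, (∑ j, ‖E i j - lam * E j i‖ ^ 2) * ∑ j, ‖u j‖ ^ 2 := sum_le_sum fun i _ => h1 i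
    _ = (∑ i, ∑ j, ‖E i j - lam * E j i‖ ^ 2) * ∑ j, ‖u j‖ ^ 2 := by rw [sum_mul]
    _ ≤ (‖1 - lam‖ ^ 2 * ∑ i, ∑ j, ‖E i j‖ ^ 2) * ∑ j, ‖u j‖ ^ 2 := by gcongr
    _ = _ := by ring

open Finset in
lemma geom_aux1 (m : ℕ) (hm : 1 ≤ m) (t : ℝ) (ht : 0 ≤ t) :
    ∑ j ∈ range (m + 1), t ^ j ≤ (∑ j ∈ range m, t ^ j) * (1 + t) := by
  have h : ∑ j ∈ range (m + 1), t ^ j = t * ∑ j ∈ range m, t ^ j + 1 := by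
    rw [sum_range_succ', mul_sum]; simp [pow_succ, mul_comm]
  have h1 : (1 : ℝ) ≤ ∑ j ∈ range m, t ^ j := by
    obtain ⟨k, rfl⟩ : ∃ k, m = k + 1 := ⟨m - 1, by omega⟩
    rw [sum_range_succ']
    have : 0 ≤ ∑ k ∈ range k, t ^ (k + 1) := sum_nonneg fun _ _ => by positivity
    simp; linarith
  rw [h]; linarith

open Finset in
lemma geom_aux2 (m : ℕ) (t : ℝ) (ht : 0 ≤ t) :
    ((m : ℝ) + 1) * ((∑ j ∈ range m, t ^ j) * (1 + t)) ≤ 2 * m * ∑ j ∈ range (m + 1), t ^ j := by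
  have h : ∑ j ∈ range (m + 1), t ^ j = t * ∑ j ∈ range m, t ^ j + 1 := by
    rw [sum_range_succ', mul_sum]; simp [pow_succ, mul_comm]
  have h' : ∑ j ∈ range (m + 1), t ^ j = ∑ j ∈ range m, t ^ j + t ^ m := sum_range_succ _ _
  have hrefl : ∑ j ∈ range (m + 1), t ^ (m - j) = ∑ j ∈ range (m + 1), t ^ j := by
    have := sum_range_reflect (fun j => t ^ j) (m + 1)
    simpa using this
  have hpos : 0 ≤ ∑ j ∈ range (m + 1), (1 - t ^ j) * (1 - t ^ (m - j)) := by
    refine sum_nonneg fun j _ => ?_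
    rcases le_total t 1 with h1 | h1
    · exact mul_nonneg (sub_nonneg.2 (pow_le_one₀ ht h1)) (sub_nonneg.2 (pow_le_one₀ ht h1))
    · exact mul_nonneg_of_nonpos_of_nonpos (sub_nonpos.2 (one_le_pow₀ h1))
        (sub_nonpos.2 (one_le_pow₀ h1))
  have hexp : ∑ j ∈ range (m + 1), (1 - t ^ j) * (1 - t ^ (m - j))
      = (m + 1) * (1 + t ^ m) - 2 * ∑ j ∈ range (m + 1), t ^ j := by
    have : ∀ j ∈ range (m + 1), (1 - t ^ j) * (1 - t ^ (m - j))
        = (1 + t ^ m) - t ^ j - t ^ (m - j) := by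
      intro j hj
      have e : t ^ m = t ^ j * t ^ (m - j) := by
        rw [← pow_add]; congr 1; have := mem_range.1 hj; omega
      rw [e]; ring
    rw [sum_congr rfl this, sum_sub_distrib, sum_sub_distrib, hrefl]
    simp; ring
  set G := ∑ j ∈ range m, t ^ j
  set H := ∑ j ∈ range (m + 1), t ^ j
  have e : G * (1 + t) = 2 * H - 1 - t ^ m := by linarith
  rw [e]
  nlinarith

open Finset in
lemma norm_uLam {m n : ℕ} (lam : ℂ) (x : Fin n → ℂ) (hx : ∑ i, ‖x i‖ ^ 2 = 1) :
    ∑ p, ‖vKron (Lam1 m lam) x p‖ ^ 2 = ∑ j ∈ range m, (‖lam‖ ^ 2) ^ j := by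
  rw [Fintype.sum_prod_type]
  simp only [vKron, Lam1, norm_mul, mul_pow, ← mul_sum, hx, mul_one]
  rw [Fin.sum_univ_eq_sum_range (fun i => ‖lam ^ (m - 1 - i)‖ ^ 2) m,
    sum_range_reflect (fun i => ‖lam ^ i‖ ^ 2) m]
  refine sum_congr rfl fun j _ => ?_
  rw [norm_pow, ← pow_mul, ← pow_mul, mul_comm]

lemma arith_low (t m N F d D s : ℝ) (ht : 0 ≤ t) (hm0 : 0 < m) (hd0 : 0 < d)
    (hD0 : 0 < D) (hF0 : 0 ≤ F) (g2 : (m + 1) * (s * (1 + t)) ≤ 2 * m * D)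
    (hlow : N ≤ s * d * F) :
    (1 + t) / d * ((m + 1) / m) * (N / D) ≤ 2 * F := by
  have key : (1 + t) * (m + 1) * N ≤ 2 * F * (d * m * D) := by
    calc (1 + t) * (m + 1) * N ≤ (1 + t) * (m + 1) * (s * d * F) := by gcongr
      _ = ((m + 1) * (s * (1 + t))) * (d * F) := by ring
      _ ≤ (2 * m * D) * (d * F) := by gcongr
      _ = _ := by ring
  have e : (1 + t) / d * ((m + 1) / m) * (N / D) = (1 + t) * (m + 1) * N / (d * m * D) := by
    field_simp
  rw [e, div_le_iff₀ (by positivity)]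
  exact key

set_option maxHeartbeats 1000000 in
/-- Frobenius backward-error comparison between a T-anti-palindromic
linearization `L_ap` (ansatz `Rv = −v`) of a T-palindromic polynomial `P`, for Re λ ≤ 0. -/
theorem stmt_14 {m n : ℕ} (hm : 1 ≤ m) (hn : 0 < n)
    (A : ℕ → Matrix (Fin n) (Fin n) ℂ)
    (hpal : ∀ j ≤ m, A (m - j) = (A j).transpose)
    (hreg : ∃ z : ℂ, (evalP m A z).det ≠ 0)
    (v : Fin m → ℂ) (hv1 : vnorm v = 1) (hvR : ∀ i : Fin m, v i.rev = -v i)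
    (X Y : Matrix (Fin m × Fin n) (Fin m × Fin n) ℂ) (hXY : X = -Y.transpose)
    (hL : ∀ z : ℂ, (z • X + Y) * colKron (Lam1 m z) (1 : Matrix (Fin n) (Fin n) ℂ)
        = colKron v (evalP m A z))
    (lam : ℂ) (hre : lam.re ≤ 0)
    (x : Fin n → ℂ) (hx : vnorm x = 1)
    (hnz : (evalP m A lam).mulVec x ≠ 0) :
    Real.sqrt (1 + 2 * lam.re / ‖1 - lam‖ ^ 2) * Real.sqrt (((m : ℝ) + 1) / m) ≤
        etaPencilF_Tapal X Y lam (vKron (Lam1 m lam) x) /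
          (vnorm ((evalP m A lam).mulVec x) / Real.sqrt (LamNormSq m lam)) ∧
      etaPencilF_Tapal X Y lam (vKron (Lam1 m lam) x) /
          (vnorm ((evalP m A lam).mulVec x) / Real.sqrt (LamNormSq m lam)) ≤
        Real.sqrt 2 := by
  -- basic quantities
  have hN : 0 < ∑ i, ‖(evalP m A lam).mulVec x i‖ ^ 2 := by
    obtain ⟨i, hi⟩ := Function.ne_iff.1 hnz
    have hi' : (evalP m A lam).mulVec x i ≠ 0 := hi
    exact Finset.sum_pos' (fun _ _ => by positivity) ⟨i, Finset.mem_univ _, by positivity⟩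
  have hx' : ∑ i, ‖x i‖ ^ 2 = 1 := by
    have := hx; unfold vnorm at this; exact (Real.sqrt_eq_one).1 this
  have hv' : ∑ i, ‖v i‖ ^ 2 = 1 := by
    have := hv1; unfold vnorm at this; exact (Real.sqrt_eq_one).1 this
  set u := vKron (Lam1 m lam) x with hu
  set y := (evalP m A lam).mulVec x with hy
  have hus : ∑ p, ‖u p‖ ^ 2 = ∑ j ∈ Finset.range m, (‖lam‖ ^ 2) ^ j := norm_uLam lam x hx'
  have hr : (lam • X + Y).mulVec u = vKron v y := by
    have hu2 : u = (colKron (Lam1 m lam) (1 : Matrix (Fin n) (Fin n) ℂ)).mulVec x := by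
      ext p
      simp [hu, vKron, colKron, Matrix.mulVec, dotProduct, Matrix.one_apply]
    rw [hu2, Matrix.mulVec_mulVec, hL]
    ext p
    simp [vKron, colKron, hy, Matrix.mulVec, dotProduct, Finset.mul_sum, mul_assoc]
  have hrn : ∑ p, ‖vKron v y p‖ ^ 2 = ∑ i, ‖y i‖ ^ 2 := by
    rw [Fintype.sum_prod_type]
    simp only [vKron, norm_mul, mul_pow, ← Finset.mul_sum, ← Finset.sum_mul, hv', one_mul]
  have hcon : ∀ E : Matrix (Fin m × Fin n) (Fin m × Fin n) ℂ,
      (lam • X + Y + lam • (-E.transpose) + E).mulVec u = 0 ↔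
        ∀ i, ∑ j, (E i j - lam * E j i) * u j = - vKron v y i := by
    intro E
    rw [add_assoc, Matrix.add_mulVec, hr, funext_iff]
    refine forall_congr' fun i => ?_
    have : (lam • (-E.transpose) + E).mulVec u i = ∑ j, (E i j - lam * E j i) * u j := by
      simp only [Matrix.mulVec, dotProduct]
      refine Finset.sum_congr rfl fun j _ => ?_
      simp [Matrix.transpose_apply]; left; ring
    rw [Pi.add_apply, this, Pi.zero_apply, add_comm, add_eq_zero_iff_eq_neg]
  have hfr : ∀ E : Matrix (Fin m × Fin n) (Fin m × Fin n) ℂ,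
      frobNorm (-E.transpose) ^ 2 + frobNorm E ^ 2 = 2 * ∑ i, ∑ j, ‖E i j‖ ^ 2 := by
    intro E
    unfold frobNorm
    have nn : ∀ B : Matrix (Fin m × Fin n) (Fin m × Fin n) ℂ, 0 ≤ ∑ i, ∑ j, ‖B i j‖ ^ 2 :=
      fun B => Finset.sum_nonneg fun _ _ => Finset.sum_nonneg fun _ _ => sq_nonneg _
    rw [Real.sq_sqrt (nn _), Real.sq_sqrt (nn _), two_mul]
    congr 1
    simp only [Matrix.neg_apply, Matrix.transpose_apply, norm_neg]
    exact Finset.sum_comm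
  have hD : LamNormSq m lam = ∑ j ∈ Finset.range (m + 1), (‖lam‖ ^ 2) ^ j := by
    simp only [LamNormSq, pow_mul]
  set t : ℝ := ‖lam‖ ^ 2 with ht
  have ht0 : 0 ≤ t := by positivity
  have g1 := geom_aux1 m hm t ht0
  have g2 := geom_aux2 m t ht0
  rw [← hD, ← hus] at g1 g2
  have hD0 : 0 < LamNormSq m lam := by
    rw [hD, Finset.sum_range_succ']
    have : 0 ≤ ∑ k ∈ Finset.range m, t ^ (k + 1) := Finset.sum_nonneg fun _ _ => by positivity
    simp; linarith
  have hs0 : 0 < ∑ p, ‖u p‖ ^ 2 := by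
    by_contra hcontra
    have : (∑ p, ‖u p‖ ^ 2) * (1 + t) ≤ 0 :=
      mul_nonpos_of_nonpos_of_nonneg (not_lt.1 hcontra) (by linarith)
    linarith
  have hd : ‖1 - lam‖ ^ 2 = 1 + t - 2 * lam.re := by
    rw [ht]
    simp only [← Complex.normSq_eq_norm_sq, Complex.normSq_apply, Complex.sub_re, Complex.sub_im,
      Complex.one_re, Complex.one_im]
    ring
  have hd0 : 0 < ‖1 - lam‖ ^ 2 := by rw [hd]; linarith
  have hA : 1 + 2 * lam.re / ‖1 - lam‖ ^ 2 = (1 + t) / ‖1 - lam‖ ^ 2 := by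
    rw [eq_div_iff hd0.ne', add_mul, div_mul_cancel₀ _ hd0.ne', hd]; ring
  have hm0 : (0 : ℝ) < m := by exact_mod_cast hm
  obtain ⟨E₀, hE₀, hE₀n⟩ := exists_pert lam hre u (vKron v y) hs0
  rw [hrn, ← ht] at hE₀n
  have hvy : vnorm y = Real.sqrt (∑ i, ‖y i‖ ^ 2) := rfl
  have hq0 : 0 < vnorm y / Real.sqrt (LamNormSq m lam) := by
    rw [hvy]; exact div_pos (Real.sqrt_pos.2 hN) (Real.sqrt_pos.2 hD0)
  have hmem : Real.sqrt (frobNorm (-E₀.transpose) ^ 2 + frobNorm E₀ ^ 2) ∈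
      { e : ℝ | ∃ ΔX ΔY : Matrix (Fin m × Fin n) (Fin m × Fin n) ℂ,
    ΔX = -ΔY.transpose ∧
    (lam • X + Y + lam • ΔX + ΔY).mulVec u = 0 ∧
    e = Real.sqrt (frobNorm ΔX ^ 2 + frobNorm ΔY ^ 2) } :=
    ⟨-E₀.transpose, E₀, rfl, (hcon E₀).2 hE₀, rfl⟩
  rw [le_div_iff₀ hq0, div_le_iff₀ hq0, hA, hvy]
  set N := ∑ i, ‖y i‖ ^ 2
  set D := LamNormSq m lam
  set d := ‖1 - lam‖ ^ 2
  set s := ∑ p, ‖u p‖ ^ 2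
  constructor
  · refine le_csInf ⟨_, hmem⟩ ?_
    rintro e ⟨ΔX, E, rfl, hE, rfl⟩
    have hlow := pert_lower lam hre u (vKron v y) E ((hcon E).1 hE)
    rw [hrn] at hlow
    rw [hfr]
    set F := ∑ i, ∑ j, ‖E i j‖ ^ 2
    have hF0 : 0 ≤ F := Finset.sum_nonneg fun _ _ => Finset.sum_nonneg fun _ _ => sq_nonneg _
    rw [← Real.sqrt_div' _ hD0.le, ← Real.sqrt_mul (div_nonneg (by linarith) hd0.le),
      ← Real.sqrt_mul (mul_nonneg (div_nonneg (by linarith) hd0.le) (div_nonneg (by linarith) hm0.le))]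
    apply Real.sqrt_le_sqrt
    exact arith_low t m N F d D s ht0 hm0 hd0 hD0 hF0 g2 hlow
  · refine (csInf_le ⟨0, ?_⟩ hmem).trans ?_
    · rintro e ⟨_, _, _, _, rfl⟩
      exact Real.sqrt_nonneg _
    · rw [hfr, ← Real.sqrt_div' _ hD0.le, ← Real.sqrt_mul (by norm_num)]
      apply Real.sqrt_le_sqrt
      set F := ∑ i, ∑ j, ‖E₀ i j‖ ^ 2
      have hF0 : 0 ≤ F := Finset.sum_nonneg fun _ _ => Finset.sum_nonneg fun _ _ => sq_nonneg _
      have : F ≤ N / D := by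
        rw [le_div_iff₀ hD0]
        exact (mul_le_mul_of_nonneg_left g1 hF0).trans hE₀n
      linarith
end
end
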